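/- Let A be a finite algebra that has a Taylor term, and let α, β be congruences of A with [α,β] = [β,α]. Let A(α) be the subalgebra of A × A with universe {(x,y) : (x,y) ∈ α}, identify each matrix [[x,y],[u,v]] ∈ M(α,β) with the pair of columns ((x,u),(y,v)) so that M(α,β) is a binary relation on A(α), and let Δ_{α,β} be the transitive closure of this relation. Then whenever ((x,u),(y,v)) ∈ Δ_{α,β} and (x,y) ∈ [α,β], it follows that (u,v) ∈ [α,β]. -/

import Mathlib

open FirstOrder FirstOrder.Language FirstOrder.Language.Structure

/-- A congruence on an `L`-structure: an equivalence relation preserved by every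
basic operation. -/
def IsCong (L : FirstOrder.Language) (A : Type*) [L.Structure A] (r : A → A → Prop) : Prop :=
  Equivalence r ∧ ∀ (n : ℕ) (f : L.Functions n) (x y : Fin n → A),
    (∀ i, r (x i) (y i)) → r (funMap f x) (funMap f y)

/-- The congruence generated by a set of pairs: the intersection of all congruences
containing the set. -/
def cgSet (L : FirstOrder.Language) (A : Type*) [L.Structure A] (s : Set (A × A)) :
    A → A → Prop :=
  fun x y => ∀ r : A → A → Prop, IsCong L A r → (∀ p ∈ s, r p.1 p.2) → r x y

/-- `Cg^A(a,b)`: the least congruence containing `(a,b)`. -/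
def cgPair (L : FirstOrder.Language) (A : Type*) [L.Structure A] (a b : A) : A → A → Prop :=
  cgSet L A {(a, b)}

/-- The term condition `C(α,β;δ)`. -/
def TermCond (L : FirstOrder.Language) (A : Type*) [L.Structure A]
    (α β δ : A → A → Prop) : Prop :=
  ∀ (n : ℕ) (t : L.Term (Fin (n + 1))) (a a' : A), α a a' →
    ∀ u v : Fin n → A, (∀ i, β (u i) (v i)) →
      δ (t.realize (Fin.cons a u)) (t.realize (Fin.cons a v)) →
      δ (t.realize (Fin.cons a' u)) (t.realize (Fin.cons a' v))

/-- The commutator `[α,β]`: the least congruence `δ` such that `C(α,β;δ)` holds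
(the intersection of all such `δ`). -/
def commut (L : FirstOrder.Language) (A : Type*) [L.Structure A] (α β : A → A → Prop) :
    A → A → Prop :=
  fun x y => ∀ δ : A → A → Prop, IsCong L A δ → TermCond L A α β δ → δ x y

/-- An algebra is idempotent if every basic operation satisfies `f(a,…,a) = a`. -/
def IsIdem (L : FirstOrder.Language) (A : Type*) [L.Structure A] : Prop :=
  ∀ (n : ℕ) (f : L.Functions n) (a : A), funMap f (fun _ => a) = a

/-- A ternary term `d` is a difference term operation for `A` if `d(a,a,b) = b` and
`(a, d(a,b,b)) ∈ [θ,θ]` where `θ = Cg^A(a,b)`. -/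
def IsDTO (L : FirstOrder.Language) (A : Type*) [L.Structure A] (d : L.Term (Fin 3)) : Prop :=
  ∀ a b : A, d.realize ![a, a, b] = b ∧
    commut L A (cgPair L A a b) (cgPair L A a b) a (d.realize ![a, b, b])

/-- A local difference term operation for a triple `(a, b, i) ∈ A² × {0,1}`
(`i = 1` is encoded as `true`). -/
def IsLDTO (L : FirstOrder.Language) (A : Type*) [L.Structure A] (t : L.Term (Fin 3))
    (s : A × A × Bool) : Prop :=
  if s.2.2 then t.realize ![s.1, s.1, s.2.1] = s.2.1
  else commut L A (cgPair L A s.1 s.2.1) (cgPair L A s.1 s.2.1) s.1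
    (t.realize ![s.1, s.2.1, s.2.1])

/-- The coordinatewise `L`-structure on a product. -/
def prodStructure (L : FirstOrder.Language) (A B : Type*) [L.Structure A] [L.Structure B] :
    L.Structure (A × B) where
  funMap f x := (funMap f fun i => (x i).1, funMap f fun i => (x i).2)
  RelMap r x := RelMap r (fun i => (x i).1) ∧ RelMap r (fun i => (x i).2)

/-- The quotient structure on `Quotient s` induced by the structure on `A`. -/
noncomputable def quotStructure (L : FirstOrder.Language) (A : Type*) [L.Structure A] (s : Setoid A) :
    L.Structure (Quotient s) where
  funMap f x := ⟦funMap f fun i => (x i).out⟧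
  RelMap r x := RelMap r fun i => (x i).out

/-- Generators of `M(α,β)`: the matrices `[[a,a],[a',a']]` with `(a,a') ∈ α` together with
the matrices `[[b,b'],[b,b']]` with `(b,b') ∈ β`; a matrix `[[x,y],[u,v]]` is encoded as its
pair of rows `((x,y),(u,v))`. -/
def matGens (A : Type*) (α β : A → A → Prop) : Set ((A × A) × (A × A)) :=
  {m | (∃ x y, α x y ∧ m = ((x, x), (y, y))) ∨ ∃ x y, β x y ∧ m = ((x, y), (x, y))}

/-- `M(α,β)`: the subalgebra of `A⁴` (with the coordinatewise structure) generated
by `matGens A α β`. -/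
def Mset (L : FirstOrder.Language) (A : Type*) [L.Structure A] (α β : A → A → Prop) :
    Set ((A × A) × (A × A)) :=
  letI : L.Structure (A × A) := prodStructure L A A
  letI : L.Structure ((A × A) × (A × A)) := prodStructure L (A × A) (A × A)
  (Substructure.closure L (matGens A α β) : Set ((A × A) × (A × A)))

/-- `A` has a Taylor term: an idempotent `n`-ary term `t` such that for each coordinate `i`,
`A` satisfies a two-variable identity `t(z₁,…,zₙ) ≈ t(w₁,…,wₙ)` where each `zⱼ, wⱼ` is one of
the two variables, `zᵢ` is the first variable and `wᵢ` is the second. -/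
def HasTaylorTerm (L : FirstOrder.Language) (A : Type*) [L.Structure A] : Prop :=
  ∃ (n : ℕ) (t : L.Term (Fin n)),
    (∀ a : A, t.realize (fun _ => a) = a) ∧
    ∀ i : Fin n, ∃ z w : Fin n → Fin 2, z i = 0 ∧ w i = 1 ∧
      ∀ v : Fin 2 → A, t.realize (v ∘ z) = t.realize (v ∘ w)

section CommutatorLemmas

variable {L : FirstOrder.Language} {A : Type*} [L.Structure A]

namespace IsCong

variable {r : A → A → Prop}

theorem refl (h : IsCong L A r) (a : A) : r a a := h.1.refl a

theorem symm (h : IsCong L A r) {a b : A} (hab : r a b) : r b a := h.1.symm hab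

theorem trans (h : IsCong L A r) {a b c : A} (hab : r a b) (hbc : r b c) : r a c :=
  h.1.trans hab hbc

theorem realize (h : IsCong L A r) {ι : Type*} (t : L.Term ι) {p q : ι → A}
    (hpq : ∀ i, r (p i) (q i)) : r (t.realize p) (t.realize q) := by
  induction t with
  | var a => exact hpq a
  | func f ts ih => exact h.2 _ f _ _ ih

end IsCong

theorem commut_isCong (α β : A → A → Prop) : IsCong L A (commut L A α β) :=
  ⟨⟨fun x _ hδ _ => hδ.refl x, fun h δ hδ ht => hδ.symm (h δ hδ ht),
    fun h h' δ hδ ht => hδ.trans (h δ hδ ht) (h' δ hδ ht)⟩,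
   fun n f _ _ h δ hδ ht => hδ.2 n f _ _ fun i => h i δ hδ ht⟩

theorem commut_termCond (α β : A → A → Prop) : TermCond L A α β (commut L A α β) :=
  fun n t a a' ha u v huv h δ hδ ht => ht n t a a' ha u v huv (h δ hδ ht)

theorem commut_le_left {α : A → A → Prop} (hα : IsCong L A α) (β : A → A → Prop) {a b : A}
    (h : commut L A α β a b) : α a b := by
  refine h α hα fun n t a a' ha u v _ h => ?_
  have key : ∀ w : Fin n → A, α (t.realize (Fin.cons a w)) (t.realize (Fin.cons a' w)) :=
    fun w => hα.realize t fun i => by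
      refine Fin.cases ?_ (fun j => ?_) i
      · simpa using ha
      · simpa using hα.refl (w j)
  exact hα.trans (hα.symm (key u)) (hα.trans h (key v))

/-- `[[p, q], [p', q']]` is one of the generating matrices of `M(α, β)`. -/
def IsMatGen (α β : A → A → Prop) (p q p' q' : A) : Prop :=
  (p = q ∧ p' = q' ∧ α p p') ∨ (p = p' ∧ q = q' ∧ β p q)

theorem TermCond.realize_fin {α β δ : A → A → Prop} (hβ : IsCong L A β)
    (h : TermCond L A α β δ) {n : ℕ} (t : L.Term (Fin n)) {p q p' q' : Fin n → A}
    (hg : ∀ i, IsMatGen α β (p i) (q i) (p' i) (q' i))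
    (hδ : δ (t.realize p) (t.realize q)) : δ (t.realize p') (t.realize q') := by
  have hβ' : ∀ i, p i ≠ q i → p i = p' i ∧ q i = q' i ∧ β (p i) (q i) := fun i hi =>
    (hg i).resolve_left fun hc => hi hc.1
  have key : ∀ s : Finset (Fin n),
      δ (t.realize (s.piecewise p' p)) (t.realize (s.piecewise q' q)) := by
    intro s
    induction s using Finset.induction_on with
    | empty => simpa using hδ
    | insert i s hi ih =>
      rcases hg i with ⟨hpq, hpq', hα⟩ | ⟨hp, hq, -⟩
      · have hre : ∀ (a : A) (w : Fin n → A),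
            (t.relabel (fun j => if j = i then (0 : Fin (n + 1)) else j.succ)).realize
              (Fin.cons a w : Fin (n + 1) → A) = t.realize (Function.update w i a) := by
          intro a w
          rw [FirstOrder.Language.Term.realize_relabel]
          congr 1
          funext j
          by_cases hj : j = i
          · subst hj; simp
          · simp [hj]
        have hs : ∀ f g : Fin n → A,
            (insert i s).piecewise f g = Function.update (s.piecewise f g) i (f i) :=
          fun f g => Finset.piecewise_insert s f g i
        have hs' : ∀ f g : Fin n → A,
            s.piecewise f g = Function.update (s.piecewise f g) i (g i) := fun f g => by
          rw [Function.eq_update_self_iff]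
          simp [hi]
        rw [hs, hs, ← hpq', ← hre, ← hre]
        refine h n _ (p i) (p' i) hα _ _ (fun j => ?_) ?_
        · rcases hg j with ⟨h1, h2, -⟩ | ⟨h1, h2, h3⟩
          · simp only [Finset.piecewise, h1, h2]
            exact hβ.refl _
          · simpa only [Finset.piecewise, ← h1, ← h2, ite_self] using h3
        · rw [hre, hre]
          conv => arg 2; rw [hpq]
          rwa [← hs', ← hs']
      · have hs : ∀ f g : Fin n → A, g i = f i → (insert i s).piecewise f g = s.piecewise f g := by
          intro f g hfg
          rw [Finset.piecewise_insert, ← hfg, Function.update_eq_self_iff]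
          simp [hi]
        rwa [hs _ _ hp, hs _ _ hq]
  simpa using key Finset.univ

theorem TermCond.realize {α β δ : A → A → Prop} (hβ : IsCong L A β)
    (h : TermCond L A α β δ) {ι : Type*} (t : L.Term ι) {p q p' q' : ι → A}
    (hg : ∀ i, IsMatGen α β (p i) (q i) (p' i) (q' i))
    (hδ : δ (t.realize p) (t.realize q)) : δ (t.realize p') (t.realize q') := by
  classical
  let e := t.varFinset.equivFin
  have hre : ∀ v : ι → A, (t.restrictVar e).realize (fun j => v (e.symm j)) = t.realize v :=
    fun v => FirstOrder.Language.Term.realize_restrictVar v fun a => by simp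
  rw [← hre p', ← hre q']
  rw [← hre p, ← hre q] at hδ
  exact h.realize_fin hβ _ (fun j => hg (e.symm j)) hδ

theorem realize_prodStructure {B : Type*} [L.Structure B] {ι : Type*} (t : L.Term ι)
    (v : ι → A × B) :
    @FirstOrder.Language.Term.realize L (A × B) (prodStructure L A B) ι v t =
      (t.realize fun i => (v i).1, t.realize fun i => (v i).2) := by
  let : L.Structure (A × B) := prodStructure L A B
  induction t with
  | var a => rfl
  | func f ts ih =>
    simp only [FirstOrder.Language.Term.realize, ih]
    rfl

section Mset

variable {α β : A → A → Prop}

theorem Mset_exists_term {m : (A × A) × (A × A)} (hm : m ∈ Mset L A α β) :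
    ∃ t : L.Term (matGens A α β), m =
      ((t.realize fun g => g.1.1.1, t.realize fun g => g.1.1.2),
       (t.realize fun g => g.1.2.1, t.realize fun g => g.1.2.2)) := by
  let : L.Structure (A × A) := prodStructure L A A
  let : L.Structure ((A × A) × (A × A)) := prodStructure L (A × A) (A × A)
  obtain ⟨t, rfl⟩ := FirstOrder.Language.Substructure.mem_closure_iff_exists_term.1 hm
  refine ⟨t, ?_⟩
  rw [realize_prodStructure, realize_prodStructure, realize_prodStructure]

theorem isMatGen_of_mem_matGens {m : (A × A) × (A × A)} (hm : m ∈ matGens A α β) :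
    IsMatGen α β m.1.1 m.1.2 m.2.1 m.2.2 := by
  rcases hm with ⟨x, y, h, rfl⟩ | ⟨x, y, h, rfl⟩
  · exact Or.inl ⟨rfl, rfl, h⟩
  · exact Or.inr ⟨rfl, rfl, h⟩

theorem IsMatGen.mem_Mset {p q p' q' : A} (h : IsMatGen α β p q p' q') :
    ((p, q), (p', q')) ∈ Mset L A α β := by
  let : L.Structure (A × A) := prodStructure L A A
  let : L.Structure ((A × A) × (A × A)) := prodStructure L (A × A) (A × A)
  refine FirstOrder.Language.Substructure.subset_closure ?_
  rcases h with ⟨rfl, rfl, h⟩ | ⟨rfl, rfl, h⟩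
  · exact Or.inl ⟨_, _, h, rfl⟩
  · exact Or.inr ⟨_, _, h, rfl⟩

theorem Mset_realize {ι : Type*} (t : L.Term ι) {p q p' q' : ι → A}
    (h : ∀ i, ((p i, q i), (p' i, q' i)) ∈ Mset L A α β) :
    ((t.realize p, t.realize q), (t.realize p', t.realize q')) ∈ Mset L A α β := by
  let : L.Structure (A × A) := prodStructure L A A
  let : L.Structure ((A × A) × (A × A)) := prodStructure L (A × A) (A × A)
  have := t.realize_mem (S := FirstOrder.Language.Substructure.closure L (matGens A α β))
    (fun i => ((p i, q i), (p' i, q' i))) h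
  rwa [realize_prodStructure, realize_prodStructure, realize_prodStructure] at this

theorem Mset_swap (hβ : IsCong L A β) {x y u v : A} (h : ((x, y), (u, v)) ∈ Mset L A α β) :
    ((y, x), (v, u)) ∈ Mset L A α β := by
  obtain ⟨t, ht⟩ := Mset_exists_term h
  simp only [Prod.mk.injEq] at ht
  obtain ⟨⟨rfl, rfl⟩, rfl, rfl⟩ := ht
  refine Mset_realize t fun g => IsMatGen.mem_Mset ?_
  rcases isMatGen_of_mem_matGens g.2 with ⟨h1, h2, h3⟩ | ⟨h1, h2, h3⟩
  · exact Or.inl ⟨h1.symm, h2.symm, by rwa [← h1, ← h2]⟩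
  · exact Or.inr ⟨h2, h1, hβ.symm h3⟩

theorem Mset_row (hβ : IsCong L A β) {x y u v : A} (h : ((x, y), (u, v)) ∈ Mset L A α β) :
    β u v := by
  obtain ⟨t, ht⟩ := Mset_exists_term h
  simp only [Prod.mk.injEq] at ht
  obtain ⟨⟨rfl, rfl⟩, rfl, rfl⟩ := ht
  refine hβ.realize t fun g => ?_
  rcases isMatGen_of_mem_matGens g.2 with ⟨h1, h2, h3⟩ | ⟨h1, h2, h3⟩
  · exact h2 ▸ hβ.refl _
  · rwa [← h1, ← h2]

theorem Mset_col (hα : IsCong L A α) {x y u v : A} (h : ((x, y), (u, v)) ∈ Mset L A α β) :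
    α x u := by
  obtain ⟨t, ht⟩ := Mset_exists_term h
  simp only [Prod.mk.injEq] at ht
  obtain ⟨⟨rfl, rfl⟩, rfl, rfl⟩ := ht
  refine hα.realize t fun g => ?_
  rcases isMatGen_of_mem_matGens g.2 with ⟨-, -, h3⟩ | ⟨h1, -, -⟩
  · exact h3
  · exact h1 ▸ hα.refl _

theorem TermCond.bottom_of_top {δ : A → A → Prop} (hβ : IsCong L A β)
    (hδ : TermCond L A α β δ) {x y u v : A} (h : ((x, y), (u, v)) ∈ Mset L A α β)
    (hxy : δ x y) : δ u v := by
  obtain ⟨t, ht⟩ := Mset_exists_term h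
  simp only [Prod.mk.injEq] at ht
  obtain ⟨⟨rfl, rfl⟩, rfl, rfl⟩ := ht
  exact hδ.realize hβ t (fun g => isMatGen_of_mem_matGens g.2) hxy

variable (L α β) in
/-- The columns `c` and `d` are joined by `n` consecutive matrices of `M(α, β)`. -/
def MChain (n : ℕ) (c d : A × A) : Prop :=
  ∃ f : ℕ → A × A, f 0 = c ∧ f n = d ∧
    ∀ k < n, (((f k).1, (f (k + 1)).1), ((f k).2, (f (k + 1)).2)) ∈ Mset L A α β

namespace MChain

theorem refl (n : ℕ) {c : A × A} (hc : α c.1 c.2) : MChain L α β n c c :=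
  ⟨fun _ => c, rfl, rfl, fun _ _ => IsMatGen.mem_Mset (Or.inl ⟨rfl, rfl, hc⟩)⟩

theorem of_mem (hα : IsCong L A α) (hβ : IsCong L A β) (n : ℕ) {c d : A × A}
    (h : ((c.1, d.1), (c.2, d.2)) ∈ Mset L A α β) : MChain L α β (n + 1) c d := by
  refine ⟨fun k => if k = 0 then c else d, by simp, by simp, fun k _ => ?_⟩
  rcases k with _ | k
  · simpa using h
  · simpa using IsMatGen.mem_Mset (Or.inl ⟨rfl, rfl, Mset_col hα (Mset_swap hβ h)⟩)

theorem symm (hβ : IsCong L A β) {n : ℕ} {c d : A × A} (h : MChain L α β n c d) :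
    MChain L α β n d c := by
  obtain ⟨f, h0, hn, hf⟩ := h
  refine ⟨fun k => f (n - k), by simpa using hn, by simpa using h0, fun k hk => ?_⟩
  have := hf (n - (k + 1)) (by omega)
  rw [show n - (k + 1) + 1 = n - k by omega] at this
  exact Mset_swap hβ this

theorem realize {n : ℕ} {ι : Type*} (t : L.Term ι) {c d : ι → A × A}
    (h : ∀ i, MChain L α β n (c i) (d i)) :
    MChain L α β n (t.realize fun i => (c i).1, t.realize fun i => (c i).2)
      (t.realize fun i => (d i).1, t.realize fun i => (d i).2) := by
  choose f h0 hn hf using h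
  exact ⟨fun k => (t.realize fun i => (f i k).1, t.realize fun i => (f i k).2),
    by simp [h0], by simp [hn], fun k hk => Mset_realize t fun i => hf i k hk⟩

theorem row (hβ : IsCong L A β) {n : ℕ} {c d : A × A} (h : MChain L α β n c d) :
    β c.2 d.2 := by
  obtain ⟨f, rfl, rfl, hf⟩ := h
  induction n with
  | zero => exact hβ.refl _
  | succ n ih => exact hβ.trans (ih fun k hk => hf k (by omega)) (Mset_row hβ (hf n (by omega)))

theorem succ_cases {n : ℕ} {c d : A × A} (h : MChain L α β (n + 1) c d) :
    ∃ e, MChain L α β n c e ∧ ((e.1, d.1), (e.2, d.2)) ∈ Mset L A α β := by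
  obtain ⟨f, rfl, rfl, hf⟩ := h
  exact ⟨f n, ⟨f, rfl, rfl, fun k hk => hf k (by omega)⟩, hf n (by omega)⟩

theorem col_left (hα : IsCong L A α) {n : ℕ} {c d : A × A} (h : MChain L α β (n + 1) c d) :
    α c.1 c.2 := by
  obtain ⟨f, rfl, rfl, hf⟩ := h
  exact Mset_col hα (hf 0 (by omega))

theorem snoc {n : ℕ} {c d e : A × A} (h : MChain L α β n c d)
    (hde : ((d.1, e.1), (d.2, e.2)) ∈ Mset L A α β) : MChain L α β (n + 1) c e := by
  obtain ⟨f, rfl, rfl, hf⟩ := h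
  refine ⟨fun k => if k ≤ n then f k else e, by simp, by simp, fun k hk => ?_⟩
  rcases Nat.lt_succ_iff_lt_or_eq.1 hk with hk | rfl
  · simpa [hk.le, Nat.succ_le_iff.2 hk] using hf k hk
  · simpa using hde

end MChain

/-- If a Taylor term does not separate `u` from `v` in any coordinate for some choice of the other
arguments, then `u` and `v` are congruent, provided that `C(β, α; δ)` holds. -/
theorem IsCong.rel_of_coordinatewise {n : ℕ} {t : L.Term (Fin n)} {δ : A → A → Prop}
    (hidem : ∀ a : A, t.realize (fun _ => a) = a) (hα : IsCong L A α) (hβ : IsCong L A β)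
    (hδ : IsCong L A δ) (hC : TermCond L A β α δ) {u v : A} (hαuv : α u v) (hβuv : β u v)
    (h : ∀ i, ∃ c : Fin n → A, (∀ j, β u (c j)) ∧
      δ (t.realize (Function.update c i u)) (t.realize (Function.update c i v))) : δ u v := by
  have key : ∀ s : Finset (Fin n), δ u (t.realize (s.piecewise (fun _ => v) fun _ => u)) := by
    intro s
    induction s using Finset.induction_on with
    | empty => simpa [hidem] using hδ.refl u
    | insert i s hi ih =>
      refine hδ.trans ih ?_
      obtain ⟨c, hc, hct⟩ := h i
      have hu : s.piecewise (fun _ => v) (fun _ => u) =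
          Function.update (s.piecewise (fun _ => v) fun _ => u) i u := by
        rw [Function.eq_update_self_iff]
        simp [hi]
      rw [Finset.piecewise_insert]
      conv => arg 1; rw [hu]
      refine hC.realize hα t (fun j => ?_) hct
      by_cases hj : j = i
      · subst hj
        simpa [IsMatGen] using Or.inr hαuv
      · refine Or.inl ⟨by simp [hj], by simp [hj], ?_⟩
        simp only [Function.update_of_ne hj, Finset.piecewise]
        split_ifs
        · exact hβ.trans (hβ.symm (hc j)) hβuv
        · exact hβ.symm (hc j)
  simpa [hidem] using key Finset.univ

theorem MChain.bottom_of_top (htaylor : HasTaylorTerm L A) {δ : A → A → Prop}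
    (hα : IsCong L A α) (hβ : IsCong L A β) (hδ : IsCong L A δ) (hδα : ∀ a b, δ a b → α a b)
    (hC : TermCond L A α β δ) (hC' : TermCond L A β α δ) (n : ℕ) :
    ∀ {c d : A × A}, MChain L α β (n + 1) c d → δ c.1 d.1 → δ c.2 d.2 := by
  induction n with
  | zero =>
    rintro c d ⟨f, rfl, rfl, hf⟩ h
    exact hC.bottom_of_top hβ (hf 0 (by omega)) h
  | succ n ih =>
    intro c d hcd h
    obtain ⟨e, hce, hed⟩ := hcd.succ_cases
    have hde := Mset_swap hβ hed
    have hc : α c.1 c.2 := hcd.col_left hα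
    have hd : α d.1 d.2 := Mset_col hα hde
    have he : α e.1 e.2 := Mset_col hα hed
    obtain ⟨N, t, hidem, ht⟩ := htaylor
    refine IsCong.rel_of_coordinatewise hidem hα hβ hδ hC'
      (hα.trans (hα.symm hc) (hα.trans (hδα _ _ h) hd)) (hcd.row hβ) fun i => ?_
    obtain ⟨z, w, hzi, hwi, hzw⟩ := ht i
    let g : Fin 2 → A × A := ![c, e]
    have hg : ∀ a b, MChain L α β (n + 1) (g a) (g b) := by
      intro a b
      fin_cases a <;> fin_cases b
      · exact .refl _ hc
      · exact hce
      · exact hce.symm hβ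
      · exact .refl _ he
    have htop : t.realize (fun j => (g (z j)).1) = t.realize (fun j => (g (w j)).1) :=
      hzw fun a => (g a).1
    have hchain : ∀ c' : A × A, MChain L α β (n + 1) c' e → δ c.1 c'.1 →
        δ (t.realize (Function.update (fun j => (g (z j)).2) i c'.2))
          (t.realize fun j => (g (w j)).2) := by
      intro c' hc' hcc'
      have := ih (MChain.realize t
        (c := Function.update (fun j => g (z j)) i c') (d := fun j => g (w j)) fun j => by
          by_cases hj : j = i
          · subst hj
            simpa [hwi, g] using hc'
          · simpa [hj] using hg (z j) (w j)) ?_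
      · convert this using 3 with j
        by_cases hj : j = i
        · subst hj; simp
        · simp [hj]
      · refine htop ▸ hδ.realize t fun j => ?_
        by_cases hj : j = i
        · subst hj
          simpa [hzi, g] using hδ.symm hcc'
        · simpa [hj] using hδ.refl _
    refine ⟨fun j => (g (z j)).2, fun j => (hg 0 (z j)).row hβ, ?_⟩
    exact hδ.trans (hchain c hce (hδ.refl _))
      (hδ.symm (hchain d (.of_mem hα hβ n hde) h))

end Mset

end CommutatorLemmas

theorem stmt11 {L : FirstOrder.Language} [L.IsAlgebraic] (A : Type*) [L.Structure A] [Finite A]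
    (htaylor : HasTaylorTerm L A)
    (α β : A → A → Prop) (hα : IsCong L A α) (hβ : IsCong L A β)
    (hsymm : commut L A α β = commut L A β α) :
    -- `Δ_{α,β}` is the transitive closure of `M(α,β)` viewed as a binary relation on
    -- `A(α) ⊆ A × A`, identifying the matrix `[[x,y],[u,v]]` with the pair of its
    -- columns `((x,u),(y,v))`.
    ∀ x u y v : A,
      Relation.TransGen
        (fun c c' : A × A => ((c.1, c'.1), (c.2, c'.2)) ∈ Mset L A α β) (x, u) (y, v) →
      commut L A α β x y → commut L A α β u v := by
  intro x u y v hchain hxy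
  have key : ∀ c d : A × A, Relation.TransGen
      (fun c c' : A × A => ((c.1, c'.1), (c.2, c'.2)) ∈ Mset L A α β) c d →
      ∃ n, MChain L α β (n + 1) c d := by
    intro c d h
    induction h with
    | single h => exact ⟨0, .of_mem hα hβ 0 h⟩
    | tail _ h ih =>
      obtain ⟨n, hn⟩ := ih
      exact ⟨n + 1, hn.snoc h⟩
  obtain ⟨n, hn⟩ := key _ _ hchain
  exact MChain.bottom_of_top htaylor hα hβ (commut_isCong α β)
    (fun _ _ => commut_le_left hα β) (commut_termCond α β)
    (hsymm ▸ commut_termCond β α) n hn hxy
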